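/- arXiv:1312.6207 — 3 statements merged into one kernel-verified Lean document; each statement's English description precedes it below -/
import Mathlib

section
/- There exist eight lines L₀, …, L₇ in ℝ³, pairwise non-parallel, and radii r₀, …, r₇ > 0 with r₀ = r₁ = r₂ = r₃ = r₅ = r₆ = 1 (six of the eight cylinders have unit radius), such that for every pair i ≠ j the infimum distance between Lᵢ and Lⱼ equals rᵢ + rⱼ. That is, eight infinitely long straight round cylinders can mutually touch, with the radii of two of them determined by the other six (the 8-knot). -/
/-- The infimum of the Euclidean distance between points of the line `{p₁ + t • v₁}`
and points of the line `{p₂ + t • v₂}`. -/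
noncomputable def lineDist (p₁ v₁ p₂ v₂ : EuclideanSpace ℝ (Fin 3)) : ℝ :=
  sInf {d : ℝ | ∃ t₁ t₂ : ℝ, d = dist (p₁ + t₁ • v₁) (p₂ + t₂ • v₂)}

/-- A cylinder is encoded by a vector `(x, y, a, b, r)`, standing for the cylinder of radius `r`
whose axis passes through `(a, b, 0)` in the direction `(x, y, 1)`. The polynomial `touchPoly`
vanishes exactly when two such cylinders with non-parallel axes (and positive radii) touch. -/
def touchPoly {R : Type*} [CommRing R] (p q : Fin 5 → R) : R :=
  ((p 2 - q 2) * (p 1 - q 1) - (p 3 - q 3) * (p 0 - q 0)) *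
      ((p 2 - q 2) * (p 1 - q 1) - (p 3 - q 3) * (p 0 - q 0)) -
    (p 4 + q 4) * (p 4 + q 4) *
      ((p 0 - q 0) * (p 0 - q 0) + (p 1 - q 1) * (p 1 - q 1) +
        (p 0 * q 1 - p 1 * q 0) * (p 0 * q 1 - p 1 * q 0))

/-- The derivative of `touchPoly` at `(p, q)` in the direction `(u, w)`. -/
def touchDiff {R : Type*} [CommRing R] (p q u w : Fin 5 → R) : R :=
  2 * ((p 2 - q 2) * (p 1 - q 1) - (p 3 - q 3) * (p 0 - q 0)) *
      ((p 2 - q 2) * (u 1 - w 1) + (p 1 - q 1) * (u 2 - w 2) -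
        ((p 3 - q 3) * (u 0 - w 0) + (p 0 - q 0) * (u 3 - w 3))) -
    ((p 4 + q 4) * (p 4 + q 4) *
        (2 * (p 0 - q 0) * (u 0 - w 0) + 2 * (p 1 - q 1) * (u 1 - w 1) +
          2 * (p 0 * q 1 - p 1 * q 0) *
            (p 0 * w 1 + q 1 * u 0 - (p 1 * w 0 + q 0 * u 1))) +
      ((p 0 - q 0) * (p 0 - q 0) + (p 1 - q 1) * (p 1 - q 1) +
          (p 0 * q 1 - p 1 * q 0) * (p 0 * q 1 - p 1 * q 0)) *
        (2 * (p 4 + q 4) * (u 4 + w 4)))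

theorem exists_zero_of_abs_sub_sub_le {ι : Type*} [Fintype ι] {G : (ι → ℝ) → ι → ℝ} {ρ : ℝ}
    (hρ : 0 ≤ ρ) (h0 : ∀ k, |G 0 k| ≤ ρ / 2)
    (hG : ∀ y y', ‖y‖ ≤ ρ → ‖y'‖ ≤ ρ → ∀ k,
      |(y k - y' k) - (G y k - G y' k)| ≤ 1 / 2 * ‖y - y'‖) :
    ∃ y, ‖y‖ ≤ ρ ∧ ∀ k, G y k = 0 := by
  set Φ : (ι → ℝ) → ι → ℝ := fun y => y - G y with hΦ
  have hlip : ∀ y y', ‖y‖ ≤ ρ → ‖y'‖ ≤ ρ → ‖Φ y - Φ y'‖ ≤ 1 / 2 * ‖y - y'‖ := by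
    intro y y' hy hy'
    refine (pi_norm_le_iff_of_nonneg (by positivity)).2 fun k => ?_
    have := hG y y' hy hy' k
    rw [Real.norm_eq_abs]
    convert this using 2
    simp only [hΦ, Pi.sub_apply]
    ring
  have hzero : ‖Φ 0‖ ≤ ρ / 2 := by
    refine (pi_norm_le_iff_of_nonneg (by positivity)).2 fun k => ?_
    simpa [hΦ] using h0 k
  have hmaps : Set.MapsTo Φ (Metric.closedBall 0 ρ) (Metric.closedBall 0 ρ) := by
    intro y hy
    rw [mem_closedBall_zero_iff] at hy ⊢
    have h1 := hlip y 0 hy (by simpa using hρ)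
    rw [sub_zero] at h1
    have h2 : ‖Φ y‖ ≤ ‖Φ y - Φ 0‖ + ‖Φ 0‖ := by
      simpa using norm_add_le (Φ y - Φ 0) (Φ 0)
    linarith
  have hcontr : ContractingWith (1 / 2)
      (hmaps.restrict Φ (Metric.closedBall 0 ρ) (Metric.closedBall 0 ρ)) := by
    refine ⟨by rw [div_lt_one (by norm_num)]; norm_num, LipschitzWith.of_dist_le_mul ?_⟩
    rintro ⟨y, hy⟩ ⟨y', hy'⟩
    rw [mem_closedBall_zero_iff] at hy hy'
    simpa [Subtype.dist_eq, dist_eq_norm] using hlip y y' hy hy'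
  obtain ⟨y, hy, hfix, -⟩ := hcontr.exists_fixedPoint' Metric.isClosed_closedBall.isComplete hmaps
    (Metric.mem_closedBall_self hρ) (edist_ne_top _ _)
  refine ⟨y, mem_closedBall_zero_iff.1 hy, fun k => ?_⟩
  have := congrFun hfix.eq k
  simp only [hΦ, Pi.sub_apply] at this
  linarith

theorem abs_mul_le_mul_of_abs_le {a b A B : ℝ} (ha : |a| ≤ A) (hb : |b| ≤ B) : |a * b| ≤ A * B := by
  rw [abs_mul]
  exact mul_le_mul ha hb (abs_nonneg _) ((abs_nonneg _).trans ha)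

theorem abs_add_four_le (a b c d : ℝ) : |a + b + c + d| ≤ |a| + |b| + |c| + |d| :=
  (abs_add_le _ _).trans (add_le_add_left (abs_add_three a b c) _)

/-- `Jet ρ δ M x x' x₀ d` records that `x` and `x'` are values, at two points of a ball of radius
`ρ` and at distance `δ` from each other, of a function with value `x₀` at the center, and that `d`
is the value of its linearization at the center on the difference of the two points. The constant
`M` bounds the value, the variation and the linearization error. -/
structure Jet (ρ δ M x x' x₀ d : ℝ) : Prop where
  abs_center : |x₀| ≤ M
  abs_left : |x - x₀| ≤ M * ρ
  abs_right : |x' - x₀| ≤ M * ρ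
  abs_diff : |x - x'| ≤ M * δ
  abs_lin : |x - x' - d| ≤ M * (ρ * δ)

namespace Jet

variable {ρ δ M N x x' x₀ d y y' y₀ e : ℝ}

theorem add (hx : Jet ρ δ M x x' x₀ d) (hy : Jet ρ δ N y y' y₀ e) :
    Jet ρ δ (M + N) (x + y) (x' + y') (x₀ + y₀) (d + e) := by
  obtain ⟨h1, h2, h3, h4, h5⟩ := hx
  obtain ⟨k1, k2, k3, k4, k5⟩ := hy
  simp only [abs_le] at *
  constructor <;> rw [abs_le] <;> constructor <;> linarith

theorem neg (hx : Jet ρ δ M x x' x₀ d) : Jet ρ δ M (-x) (-x') (-x₀) (-d) := by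
  obtain ⟨h1, h2, h3, h4, h5⟩ := hx
  simp only [abs_le] at *
  constructor <;> rw [abs_le] <;> constructor <;> linarith

theorem sub (hx : Jet ρ δ M x x' x₀ d) (hy : Jet ρ δ N y y' y₀ e) :
    Jet ρ δ (M + N) (x - y) (x' - y') (x₀ - y₀) (d - e) := by
  simpa only [sub_eq_add_neg] using hx.add hy.neg

theorem mul (hρ : ρ ≤ 1) (hx : Jet ρ δ M x x' x₀ d) (hy : Jet ρ δ N y y' y₀ e) :
    Jet ρ δ (4 * M * N) (x * y) (x' * y') (x₀ * y₀) (x₀ * e + y₀ * d) := by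
  have hM : 0 ≤ M := (abs_nonneg _).trans hx.abs_center
  have hN : 0 ≤ N := (abs_nonneg _).trans hy.abs_center
  have hMN : 0 ≤ M * N := mul_nonneg hM hN
  have hMρ : 0 ≤ M * ρ := (abs_nonneg _).trans hx.abs_left
  have hMδ : 0 ≤ M * δ := (abs_nonneg _).trans hx.abs_diff
  have hleft : ∀ {z w : ℝ}, |z - x₀| ≤ M * ρ → |w - y₀| ≤ N * ρ →
      |z * w - x₀ * y₀| ≤ 4 * M * N * ρ := by
    intro z w hz hw
    have h1 := abs_mul_le_mul_of_abs_le hz hw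
    have h2 := abs_mul_le_mul_of_abs_le hx.abs_center hw
    have h3 := abs_mul_le_mul_of_abs_le hz hy.abs_center
    have h4 : M * ρ * (N * ρ) ≤ M * ρ * N := by
      have := mul_le_mul_of_nonneg_left hρ (mul_nonneg hMρ hN)
      linarith
    have h5 : 0 ≤ M * ρ * N := mul_nonneg hMρ hN
    have h6 := abs_add_three ((z - x₀) * (w - y₀)) (x₀ * (w - y₀)) ((z - x₀) * y₀)
    have h7 : z * w - x₀ * y₀ = (z - x₀) * (w - y₀) + x₀ * (w - y₀) + (z - x₀) * y₀ := by ring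
    rw [h7]
    linarith
  refine ⟨?_, hleft hx.abs_left hy.abs_left, hleft hx.abs_right hy.abs_right, ?_, ?_⟩
  · have := abs_mul_le_mul_of_abs_le hx.abs_center hy.abs_center
    linarith
  · have h1 := abs_mul_le_mul_of_abs_le hx.abs_left hy.abs_diff
    have h2 := abs_mul_le_mul_of_abs_le hx.abs_center hy.abs_diff
    have h3 := abs_mul_le_mul_of_abs_le hx.abs_diff hy.abs_right
    have h4 := abs_mul_le_mul_of_abs_le hx.abs_diff hy.abs_center
    have h5 : ρ * (M * δ * N) ≤ 1 * (M * δ * N) :=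
      mul_le_mul_of_nonneg_right hρ (mul_nonneg hMδ hN)
    have h6 := abs_add_four_le ((x - x₀) * (y - y')) (x₀ * (y - y')) ((x - x') * (y' - y₀))
      ((x - x') * y₀)
    have h7 : x * y - x' * y' = (x - x₀) * (y - y') + x₀ * (y - y') + (x - x') * (y' - y₀) +
      (x - x') * y₀ := by ring
    rw [h7]
    linarith
  · have h1 := abs_mul_le_mul_of_abs_le hx.abs_left hy.abs_diff
    have h2 := abs_mul_le_mul_of_abs_le hx.abs_center hy.abs_lin
    have h3 := abs_mul_le_mul_of_abs_le hx.abs_diff hy.abs_right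
    have h4 := abs_mul_le_mul_of_abs_le hx.abs_lin hy.abs_center
    have h6 := abs_add_four_le ((x - x₀) * (y - y')) (x₀ * (y - y' - e)) ((x - x') * (y' - y₀))
      ((x - x' - d) * y₀)
    have h7 : x * y - x' * y' - (x₀ * e + y₀ * d) = (x - x₀) * (y - y') + x₀ * (y - y' - e) +
      (x - x') * (y' - y₀) + (x - x' - d) * y₀ := by ring
    rw [h7]
    linarith

theorem touchPoly {p p' p₀ u q q' q₀ w : Fin 5 → ℝ} (hρ : ρ ≤ 1)
    (hp : ∀ c, Jet ρ δ M (p c) (p' c) (p₀ c) (u c))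
    (hq : ∀ c, Jet ρ δ M (q c) (q' c) (q₀ c) (w c)) :
    Jet ρ δ (6144 * M ^ 4 + 16384 * M ^ 6) (_root_.touchPoly p q)
      (_root_.touchPoly p' q') (_root_.touchPoly p₀ q₀) (touchDiff p₀ q₀ u w) := by
  have hsub := fun c => (hp c).sub (hq c)
  have hdet := ((hsub 2).mul hρ (hsub 1)).sub ((hsub 3).mul hρ (hsub 0))
  have hcross := ((hp 0).mul hρ (hq 1)).sub ((hp 1).mul hρ (hq 0))
  have hrad := (hp 4).add (hq 4)
  have h := (hdet.mul hρ hdet).sub ((hrad.mul hρ hrad).mul hρ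
    ((((hsub 0).mul hρ (hsub 0)).add ((hsub 1).mul hρ (hsub 1))).add (hcross.mul hρ hcross)))
  simp only [_root_.touchPoly]
  convert h using 1
  · ring
  · simp only [touchDiff]
    ring

end Jet

theorem touchDiff_sum {κ : Type*} (s : Finset κ) (p q : Fin 5 → ℝ) (u w : κ → Fin 5 → ℝ)
    (η : κ → ℝ) :
    touchDiff p q (fun c => ∑ l ∈ s, u l c * η l) (fun c => ∑ l ∈ s, w l c * η l) =
      ∑ l ∈ s, touchDiff p q (u l) (w l) * η l := by
  classical
  induction s using Finset.induction_on with
  | empty => simp [touchDiff]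
  | insert a s ha ih =>
    simp only [Finset.sum_insert ha, ← ih]
    simp only [touchDiff]
    ring

theorem exists_common_perpendicular (a b : ℝ) {x y x' y' Q : ℝ} (hQ : Q ≠ 0)
    (hnorm : Q = (x - x') ^ 2 + (y - y') ^ 2 + (x * y' - y * x') ^ 2) :
    ∃ s t : ℝ,
      a + s * x - t * x' = (a * (y - y') - b * (x - x')) / Q * (y - y') ∧
      b + s * y - t * y' = (a * (y - y') - b * (x - x')) / Q * (x' - x) ∧
      s - t = (a * (y - y') - b * (x - x')) / Q * (x * y' - y * x') := by
  refine ⟨-(a * (y' * (x * y' - y * x') - (x' - x)) + b * (y - y' - x' * (x * y' - y * x'))) / Q,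
    -(a * (y * (x * y' - y * x') - (x' - x)) + b * (y - y' - x * (x * y' - y * x'))) / Q,
    ?_, ?_, ?_⟩
  · field_simp
    rw [hnorm]
    ring
  · field_simp
    rw [hnorm]
    ring
  · field_simp
    ring

theorem sq_sub_add_le (X Y Z a b c : ℝ) :
    (X * b - Y * a + Z * c) ^ 2 ≤ (X ^ 2 + Y ^ 2 + Z ^ 2) * (a ^ 2 + b ^ 2 + c ^ 2) := by
  linarith [sq_nonneg (X * a + Y * b), sq_nonneg (X * c - Z * b), sq_nonneg (Y * c + Z * a)]

theorem lineDist_eq_of_touchPoly_eq_zero {p q : Fin 5 → ℝ} (h0 : p 0 ≠ q 0)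
    (hr : 0 ≤ p 4 + q 4) (h : touchPoly p q = 0) :
    lineDist !₂[p 2, p 3, 0] !₂[p 0, p 1, 1] !₂[q 2, q 3, 0] !₂[q 0, q 1, 1] = p 4 + q 4 := by
  set Q := (p 0 - q 0) ^ 2 + (p 1 - q 1) ^ 2 + (p 0 * q 1 - p 1 * q 0) ^ 2 with hQ
  set D := (p 2 - q 2) * (p 1 - q 1) - (p 3 - q 3) * (p 0 - q 0) with hD
  have hQpos : 0 < Q := by
    have : 0 < (p 0 - q 0) ^ 2 := by
      have := sub_ne_zero.2 h0
      positivity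
    positivity
  have hDQ : D ^ 2 = (p 4 + q 4) ^ 2 * Q := by
    simp only [touchPoly] at h
    rw [hD, hQ]
    linarith
  refine IsLeast.csInf_eq ⟨?_, ?_⟩
  · obtain ⟨s, t, h₀, h₁, h₂⟩ := exists_common_perpendicular (p 2 - q 2) (p 3 - q 3) hQpos.ne' hQ
    refine ⟨s, t, ?_⟩
    have hsum : (p 2 + s * p 0 - (q 2 + t * q 0)) ^ 2 + (p 3 + s * p 1 - (q 3 + t * q 1)) ^ 2 +
        (s - t) ^ 2 = (p 4 + q 4) ^ 2 := by
      have e₀ : p 2 + s * p 0 - (q 2 + t * q 0) = D / Q * (p 1 - q 1) := by linarith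
      have e₁ : p 3 + s * p 1 - (q 3 + t * q 1) = D / Q * (q 0 - p 0) := by linarith
      have e₂ : s - t = D / Q * (p 0 * q 1 - p 1 * q 0) := h₂
      have e₃ : D / Q * (D / Q) * Q = (p 4 + q 4) ^ 2 := by
        rw [mul_assoc, div_mul_cancel₀ _ hQpos.ne', div_mul_eq_mul_div, ← pow_two, hDQ,
          mul_div_cancel_right₀ _ hQpos.ne']
      rw [e₀, e₁, e₂, ← e₃]
      generalize D / Q = z
      rw [hQ]
      ring
    rw [EuclideanSpace.dist_eq, eq_comm, Real.sqrt_eq_iff_eq_sq (by positivity) hr, ← hsum]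
    simp [Fin.sum_univ_three, Real.dist_eq, sq_abs]
  · rintro _ ⟨s, t, rfl⟩
    rw [EuclideanSpace.dist_eq]
    apply Real.le_sqrt_of_sq_le
    simp only [Fin.sum_univ_three, Real.dist_eq, sq_abs]
    simp
    refine le_of_mul_le_mul_right ?_ hQpos
    rw [← hDQ]
    have hdot : D = (p 2 + s * p 0 - (q 2 + t * q 0)) * (p 1 - q 1) -
        (p 3 + s * p 1 - (q 3 + t * q 1)) * (p 0 - q 0) +
        (s - t) * (p 0 * q 1 - p 1 * q 0) := by
      rw [hD]
      ring
    rw [hdot, hQ]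
    exact sq_sub_add_le _ _ _ _ _ _
def centerTable : Fin 8 → Fin 5 → ℤ :=
  ![![7355112226764, 258015042939034, -327333179452096, -392144666059459, 100000000000000],
    ![97388329362319, 64754231001837, -325257945453161, 327403347931347, 100000000000000],
    ![372030822392211, -71673581203169, 142496618646551, -222860014356880, 100000000000000],
    ![-28935094557491, -310909624782504, -83608689305836, 274017899867864, 100000000000000],
    ![154842992030910, 195305584751098, -357024613994973, -68008067533745, 10134073824496],
    ![-74833484639855, 87312758147891, 186687661026649, 5948859951032, 100000000000000],
    ![-201695864634662, 38650628261118, -420102587056708, 88988758297295, 100000000000000],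
    ![-183972238326030, 316386802973182, 420102587056708, 392144666059458, 260933330279620]]

def correctionTable : Fin 8 → Fin 5 → Fin 28 → ℤ :=
  ![![![-1679, 198, -143, 310, -620, -597, 113, 778, 416, -3264, 259, -1442, -264, -128,
      349, 397, -59, -3, -708, 111, 426, 33, 672, -394, 62, 1425, 459, -108],
     ![4067, 129, -27, -6632, -2213, 509, -451, -1231, -105, 11327, -6128, 2230, 113, -65,
      -597, 18, 710, -57, -427, -372, 13, -10, 7217, -73, 245, -2735, -9, 87],
     ![-111, -285, -109, 288, 1961, 1041, 14, -855, -866, 3871, -73, 2021, 180, 150, -413,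
      -650, 41, 30, 1266, -533, -543, -22, -2196, 478, -130, -1737, -847, 130],
     ![-3018, -281, 133, 3466, 1461, -728, 321, 1028, 318, -8921, 3819, -2165, -146, 49,
      722, 93, -728, 37, -91, 168, -65, 13, -4236, 7, -140, 2860, 61, -71],
     0],
    ![![840, -249, 315, 989, -482, 438, -129, -74, 723, -6189, -346, -218, -17, -71, 747,
      135, 65, -26, -1308, 49, -13, -1, 836, -951, 108, 216, 179, 6],
     ![1047, 189, -285, -2578, -1035, -400, -20, -324, -53, 5823, -1557, 125, -98, -51,
      -420, 61, 295, -12, 215, 34, 295, 21, 2314, 212, 56, -705, 165, -25],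
     ![228, 495, -733, -3838, -413, -948, 139, 1036, -356, 5641, -3081, -1662, -454, -187,
      -197, 560, -47, 8, -164, -705, 630, 60, 3619, -89, 123, 1670, 340, -147],
     ![2090, 154, -57, -4519, -895, 511, -136, -1059, -592, 10520, -2788, 3692, 75, 70,
      -977, -456, 554, -4, 950, -51, -240, -10, 2829, 1126, 16, -3157, -405, 118],
     0],
    ![![6357, -227, 638, -8445, -3939, 1532, -540, -478, 1134, 10536, -8243, 389, -75, -21,
      -223, 970, -400, -130, -1975, -521, -592, -4, 11625, -1020, 467, 841, 932, 54],
     ![-891, 138, -353, 1884, -340, -1032, 96, 1237, 973, -6614, 1229, -2492, -261, -205,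
      858, 120, 304, -5, -1064, 249, 774, 58, -543, -1072, 56, 774, 351, -114],
     ![4555, 66, 442, -7213, -2845, 1205, -425, -1070, 250, 10358, -6095, 1918, 95, 72,
      -168, 143, 441, -89, -860, -229, -355, -28, 7890, -651, 288, -2292, 268, 127],
     ![-190, 175, -231, -420, -361, -515, 48, 1728, 1667, -5789, -1598, -3750, -514, -249,
      1016, 721, -693, -30, -2006, -537, 302, 92, 2915, -1436, 212, 4020, 631, -146],
     0],
    ![![-2208, -183, 565, 2433, 1629, 568, 119, -458, -1220, 367, 2666, 1423, 150, 191,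
      -400, -570, -138, 34, 1398, 135, -525, -4, -4261, 792, -208, -1048, -571, 102],
     ![-3241, -175, 178, 4575, 2203, -161, 270, 2327, 1723, -13056, 2359, -4726, -566,
      201, 1159, 866, -1649, 17, -1268, -675, -323, 117, -2825, -1097, 9, 6578, 424, -141],
     ![687, 170, -208, -2215, -672, -315, 7, 701, 1209, -681, -3098, -1595, -333, -210,
      509, 556, 61, -15, -1341, -634, 582, 25, 3853, -1010, 204, 1517, 408, -127],
     ![2745, 154, 24, -5540, -1823, 380, -196, -1399, -1017, 12078, -4487, 2797, 184, 82,
      -933, -269, 719, -25, 277, -168, 193, -64, 5377, 599, 129, -2914, -122, 43],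
     0],
    ![![2406, -223, 322, -1904, -1380, 685, -221, 341, 1146, 708, -3107, -1164, -139, -176,
      1261, 563, 31, -50, -2325, -305, 84, 15, 4470, -2130, 235, 1209, 475, -25],
     ![3410, 297, -317, -7331, -2750, -256, -149, -534, 310, 10047, -6789, 1030, -144,
      -143, -446, 266, 576, -36, -656, -411, 339, 36, 8575, 324, 152, -1795, 267, -1],
     ![-1857, 307, -412, 1227, 695, -925, 192, -155, -491, 1537, -436, 787, -115, -28,
      -1016, -284, 191, 39, 471, -282, 268, 18, -505, 1751, -95, -1130, -334, -24],
     ![609, -150, 219, 1585, 227, 723, -162, -370, -58, 1392, -894, 378, 80, 47, -63, -88,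
      16, -12, -133, -207, -307, -16, 689, -1200, 61, 32, -210, 72],
     ![-47, 57, 4, -1007, 153, 97, 22, 1, -9, -225, 173, -7, 9, 2, -137, -35, 27, 5, 9,
      -6, -10, -1, -319, -193, -24, -34, -49, 6]],
    ![![-2139, 174, -341, 1369, 1602, -509, 225, 454, -145, -1643, 693, -566, -192, -45,
      -38, 27, -18, 21, 329, -99, 268, 30, -1755, 251, -73, 536, 169, -65],
     ![1251, 48, -57, -2129, -848, 55, -73, -795, -471, 6086, -2370, 1629, 97, 38, -597,
      -436, 398, 1, 661, 184, 21, -15, 1218, 597, -6, -1806, -188, 45],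
     ![2757, -236, 679, -2770, -2203, 846, -281, -239, 768, 1438, -2274, -5, 73, -7, 394,
      169, -40, -27, -1168, 907, -137, -34, 4178, -1014, 206, 314, -179, 24],
     ![1055, 384, -484, -3560, -1063, -561, -10, 1033, 1220, 1717, -5009, -2158, -521,
      -230, 398, 1433, -165, -52, -1468, -805, 401, 98, 5230, -911, 244, 1852, 773, -103],
     0],
    ![![-5219, -20, -320, 8009, 3545, -948, 416, 384, -1026, -8989, 7539, -315, 118, 107,
      -113, -743, -144, 81, 1943, 460, 109, -6, -10430, 1200, -426, 104, -784, 122],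
     ![45, -188, 244, 1172, 286, 432, -47, -1042, -959, 1901, 1724, 2006, 373, 166, -587,
      -1042, 323, 32, 1391, 633, -275, -61, -3069, 1074, -179, -5207, -793, 161],
     ![-6283, 18, -197, 7792, 3903, -1143, 544, 673, -912, -8715, 6497, -634, -89, 137,
      -58, -739, -251, 99, 1779, 28, -390, 3, -9823, 900, -387, -7, -837, 55],
     ![546, -114, 324, -744, 501, 970, -95, -818, -564, 2864, -331, 1306, 224, 153, -495,
      -668, 256, 16, 842, 12, -648, -40, -753, 957, -84, -2818, -697, 169],
     0],
    ![![-2849, 355, -1022, 3261, 1991, -1487, 319, 738, -20, -4590, 2194, -1202, -195,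
      -169, -16, -229, 291, 56, 605, -141, 949, 112, -3927, 532, -160, 632, -523, -183],
     ![3226, -107, 409, -5326, -2011, 905, -230, -1885, -860, 10731, -3728, 3504, 389, 84,
      -768, -162, 618, -85, 336, 55, -401, -87, 4672, 472, 121, -3398, 14, 169],
     ![24, -534, 538, 6729, -428, 238, -191, -91, 398, -13449, 8559, -829, 644, 74, 948,
      246, -395, -45, 17, 1447, -55, -21, -7016, -364, -208, 1665, 1180, -38],
     ![-3836, -323, 72, 9732, 1953, -780, 230, -143, -974, -13860, 11288, -99, 620, 78,
      332, -767, 42, 70, 1628, 1588, 363, -73, -12051, 857, -437, 125, -31, -82],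
     ![-6049, -506, 346, 13551, 4056, -338, 323, 3, -1481, -17255, 14633, 4, 664, 299,
      236, -846, -581, 60, 2726, 1570, -290, -97, -17201, 1496, -673, 987, -321, -11]]]

/-- An approximate configuration, accurate to about fourteen decimal places. -/
def center (i : Fin 8) (c : Fin 5) : ℚ := centerTable i c / 10 ^ 14

/-- An approximate right inverse of the derivative of the touching equations at `center`. -/
def correction (i : Fin 8) (c : Fin 5) (k : Fin 28) : ℚ := correctionTable i c k / 10 ^ 5

/-- The pairs of distinct cylinders, in lexicographic order. -/
def linePair : Fin 28 → Fin 8 × Fin 8 :=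
  ![(0, 1), (0, 2), (0, 3), (0, 4), (0, 5), (0, 6), (0, 7),
    (1, 2), (1, 3), (1, 4), (1, 5), (1, 6), (1, 7),
    (2, 3), (2, 4), (2, 5), (2, 6), (2, 7),
    (3, 4), (3, 5), (3, 6), (3, 7),
    (4, 5), (4, 6), (4, 7),
    (5, 6), (5, 7),
    (6, 7)]

theorem exists_linePair_eq : ∀ i j : Fin 8, i < j → ∃ k, linePair k = (i, j) := by
  decide

theorem abs_center_le : ∀ i c, |center i c| ≤ 5 := by
  decide +kernel

theorem center_radius_eq_one : ∀ i, i ≠ 4 → i ≠ 7 → center i 4 = 1 := by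
  decide +kernel

theorem correction_radius_eq_zero : ∀ i, i ≠ 4 → i ≠ 7 → ∀ k, correction i 4 k = 0 := by
  decide +kernel

theorem center_radius_ge : ∀ i, 1 / 10 ≤ center i 4 := by
  decide +kernel

theorem center_separated : ∀ i j, i ≠ j → 1 / 10 ≤ |center i 0 - center j 0| := by
  decide +kernel

theorem sum_abs_correction_le : ∀ i c, ∑ k, |correction i c k| ≤ 1 := by
  decide +kernel

theorem abs_touchPoly_center_le :
    ∀ k, |touchPoly (center (linePair k).1) (center (linePair k).2)| ≤ 1 / (2 * 10 ^ 10) := by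
  decide +kernel

theorem sum_abs_touchDiff_center_sub_le :
    ∀ k, ∑ l, |(if k = l then 1 else 0) -
      touchDiff (center (linePair k).1) (center (linePair k).2)
        (fun c => correction (linePair k).1 c l) (fun c => correction (linePair k).2 c l)| ≤
      1 / 4 := by
  decide +kernel

/-- The configuration obtained from `center` by the displacement with coordinates `y`. -/
noncomputable def config (y : Fin 28 → ℝ) (i : Fin 8) (c : Fin 5) : ℝ :=
  center i c + ∑ l, (correction i c l : ℝ) * y l

theorem abs_sum_mul_le {ι : Type*} [Fintype ι] (a y : ι → ℝ) :
    |∑ l, a l * y l| ≤ (∑ l, |a l|) * ‖y‖ := by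
  rw [Finset.sum_mul]
  refine (Finset.abs_sum_le_sum_abs _ _).trans (Finset.sum_le_sum fun l _ => ?_)
  rw [abs_mul]
  exact mul_le_mul_of_nonneg_left (norm_le_pi_norm y l) (abs_nonneg _)

theorem abs_sum_correction_mul_le (i : Fin 8) (c : Fin 5) (y : Fin 28 → ℝ) :
    |∑ l, (correction i c l : ℝ) * y l| ≤ ‖y‖ := by
  have h : ∑ l, |(correction i c l : ℝ)| ≤ 1 := by exact_mod_cast sum_abs_correction_le i c
  exact (abs_sum_mul_le _ y).trans (mul_le_of_le_one_left (norm_nonneg y) h)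

theorem config_sub_config (y y' : Fin 28 → ℝ) (i : Fin 8) (c : Fin 5) :
    config y i c - config y' i c = ∑ l, (correction i c l : ℝ) * (y - y') l := by
  simp only [config, Pi.sub_apply, mul_sub, Finset.sum_sub_distrib]
  ring

theorem jet_config {ρ : ℝ} {y y' : Fin 28 → ℝ} (hy : ‖y‖ ≤ ρ) (hy' : ‖y'‖ ≤ ρ) (i : Fin 8)
    (c : Fin 5) :
    Jet ρ ‖y - y'‖ 5 (config y i c) (config y' i c) (center i c)
      (∑ l, (correction i c l : ℝ) * (y - y') l) := by
  have hρ : 0 ≤ ρ := (norm_nonneg y).trans hy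
  have hball : ∀ z : Fin 28 → ℝ, ‖z‖ ≤ ρ → |config z i c - center i c| ≤ 5 * ρ := by
    intro z hz
    have := abs_sum_correction_mul_le i c z
    rw [config, add_sub_cancel_left]
    linarith
  refine ⟨by exact_mod_cast abs_center_le i c, hball y hy, hball y' hy', ?_, ?_⟩
  · have := abs_sum_correction_mul_le i c (y - y')
    rw [config_sub_config]
    linarith [norm_nonneg (y - y')]
  · rw [config_sub_config, sub_self, abs_zero]
    positivity

theorem exists_config_touchPoly_eq_zero :
    ∃ y : Fin 28 → ℝ, ‖y‖ ≤ 1 / 10 ^ 10 ∧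
      ∀ k, touchPoly (config y (linePair k).1) (config y (linePair k).2) = 0 := by
  refine exists_zero_of_abs_sub_sub_le
    (G := fun y k => touchPoly (config y (linePair k).1) (config y (linePair k).2))
    (by norm_num) (fun k => ?_) (fun y y' hy hy' k => ?_)
  · have h : (((|touchPoly (center (linePair k).1) (center (linePair k).2)| : ℚ)) : ℝ) ≤
        ((1 / (2 * 10 ^ 10) : ℚ) : ℝ) := Rat.cast_le.2 (abs_touchPoly_center_le k)
    simp only [touchPoly] at h
    push_cast at h
    simp only [touchPoly, config, Pi.zero_apply, mul_zero, Finset.sum_const_zero, add_zero]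
    refine h.trans ?_
    norm_num
  · set i := (linePair k).1 with hi
    set j := (linePair k).2 with hj
    set η := y - y' with hη
    have hlin := (Jet.touchPoly (by norm_num) (jet_config hy hy' i) (jet_config hy hy' j)).abs_lin
    rw [touchDiff_sum Finset.univ (fun c => (center i c : ℝ)) (fun c => (center j c : ℝ))
      (fun l c => (correction i c l : ℝ)) (fun l c => (correction j c l : ℝ)) η] at hlin
    set T : Fin 28 → ℝ := fun l => touchDiff (fun c => (center i c : ℝ))
      (fun c => (center j c : ℝ)) (fun c => (correction i c l : ℝ))
      (fun c => (correction j c l : ℝ)) with hT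
    have hcoef : ∑ l, |(if k = l then 1 else 0) - T l| ≤ 1 / 4 := by
      have h := (Rat.cast_le (K := ℝ)).2 (sum_abs_touchDiff_center_sub_le k)
      simp only [touchDiff] at h
      push_cast at h
      simp only [apply_ite ((↑) : ℚ → ℝ), Rat.cast_one, Rat.cast_zero] at h
      simpa only [hT, touchDiff] using h
    have happrox : |η k - ∑ l, T l * η l| ≤ 1 / 4 * ‖η‖ := by
      have h : η k - ∑ l, T l * η l = ∑ l, ((if k = l then 1 else 0) - T l) * η l := by
        simp [sub_mul, Finset.sum_sub_distrib]
      rw [h]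
      exact (abs_sum_mul_le _ η).trans (mul_le_mul_of_nonneg_right hcoef (norm_nonneg η))
    have hsplit : y k - y' k - (touchPoly (config y i) (config y j) -
        touchPoly (config y' i) (config y' j)) = (η k - ∑ l, T l * η l) -
        (touchPoly (config y i) (config y j) - touchPoly (config y' i) (config y' j) -
          ∑ l, T l * η l) := by
      simp only [hη, Pi.sub_apply]
      ring
    rw [hsplit]
    refine (abs_sub _ _).trans ?_
    linarith [norm_nonneg η]

theorem linearIndependent_direction {a b c d : ℝ} (h : a ≠ c) :
    LinearIndependent ℝ ![(!₂[a, b, 1] : EuclideanSpace ℝ (Fin 3)), !₂[c, d, 1]] := by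
  rw [LinearIndependent.pair_iff]
  intro s t hst
  have h0 := congrArg (fun v : EuclideanSpace ℝ (Fin 3) => v 0) hst
  have h2 := congrArg (fun v : EuclideanSpace ℝ (Fin 3) => v 2) hst
  simp at h0 h2
  have ht : t = -s := by linarith
  have hs : s * (a - c) = 0 := by rw [ht] at h0; linarith
  have hs0 : s = 0 := (mul_eq_zero.1 hs).resolve_right (sub_ne_zero.2 h)
  exact ⟨hs0, by rw [ht, hs0, neg_zero]⟩

theorem lineDist_comm (p₁ v₁ p₂ v₂ : EuclideanSpace ℝ (Fin 3)) :
    lineDist p₁ v₁ p₂ v₂ = lineDist p₂ v₂ p₁ v₁ := by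
  unfold lineDist
  congr 1
  ext d
  constructor <;> rintro ⟨s, t, rfl⟩ <;> exact ⟨t, s, dist_comm _ _⟩

/-- The 8-knot: eight mutually touching infinite straight round cylinders, six of
which have unit radius (the remaining two radii are determined by the others). -/
theorem stmt10 :
    ∃ (p v : Fin 8 → EuclideanSpace ℝ (Fin 3)) (r : Fin 8 → ℝ),
      (∀ i, v i ≠ 0) ∧
      (∀ i, 0 < r i) ∧
      r 0 = 1 ∧ r 1 = 1 ∧ r 2 = 1 ∧ r 3 = 1 ∧ r 5 = 1 ∧ r 6 = 1 ∧
      (∀ i j, i ≠ j → LinearIndependent ℝ ![v i, v j]) ∧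
      (∀ i j, i ≠ j → lineDist (p i) (v i) (p j) (v j) = r i + r j) := by
  obtain ⟨y, hy, hzero⟩ := exists_config_touchPoly_eq_zero
  have hdisp : ∀ i c, |config y i c - center i c| ≤ 1 / 10 ^ 10 := by
    intro i c
    rw [config, add_sub_cancel_left]
    exact (abs_sum_correction_mul_le i c y).trans hy
  have hunit : ∀ i, i ≠ 4 → i ≠ 7 → config y i 4 = 1 := by
    intro i h4 h7
    simp [config, center_radius_eq_one i h4 h7, correction_radius_eq_zero i h4 h7]
  have hpos : ∀ i, 0 < config y i 4 := by
    intro i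
    have h : ((1 / 10 : ℚ) : ℝ) ≤ center i 4 := Rat.cast_le.2 (center_radius_ge i)
    have := (abs_le.1 (hdisp i 4)).1
    push_cast at h
    norm_num at this
    linarith
  have hsep : ∀ i j, i ≠ j → config y i 0 ≠ config y j 0 := by
    intro i j hij heq
    have h : ((1 / 10 : ℚ) : ℝ) ≤ |(center i 0 : ℝ) - center j 0| := by
      exact_mod_cast center_separated i j hij
    have hi := abs_le.1 (hdisp i 0)
    have hj := abs_le.1 (hdisp j 0)
    rw [heq] at hi
    push_cast at h
    have hlt : |(center i 0 : ℝ) - center j 0| < 1 / 10 := by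
      norm_num at hi hj
      rw [abs_lt]
      constructor <;> linarith [hi.1, hi.2, hj.1, hj.2]
    linarith
  have htouch : ∀ i j, i < j → lineDist !₂[config y i 2, config y i 3, 0]
      !₂[config y i 0, config y i 1, 1] !₂[config y j 2, config y j 3, 0]
      !₂[config y j 0, config y j 1, 1] = config y i 4 + config y j 4 := by
    intro i j hij
    obtain ⟨k, hk⟩ := exists_linePair_eq i j hij
    have h := hzero k
    rw [hk] at h
    exact lineDist_eq_of_touchPoly_eq_zero (hsep i j hij.ne) (add_pos (hpos i) (hpos j)).le h
  refine ⟨fun i => !₂[config y i 2, config y i 3, 0], fun i => !₂[config y i 0, config y i 1, 1],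
    fun i => config y i 4, fun i h => ?_, hpos, hunit 0 (by decide) (by decide),
    hunit 1 (by decide) (by decide), hunit 2 (by decide) (by decide),
    hunit 3 (by decide) (by decide), hunit 5 (by decide) (by decide),
    hunit 6 (by decide) (by decide),
    fun i j hij => linearIndependent_direction (hsep i j hij), fun i j hij => ?_⟩
  · simpa using congrArg (fun v : EuclideanSpace ℝ (Fin 3) => v 2) h
  · rcases lt_or_gt_of_ne hij with h | h
    · exact htouch i j h
    · rw [lineDist_comm, add_comm]
      exact htouch j i h
end

section
/- There exist nine lines L₀, …, L₈ in ℝ³, pairwise non-parallel, and radii r₀, …, r₈ > 0 with r₀ = r₁ = 1, such that for every pair i ≠ j the infimum distance between Lᵢ and Lⱼ equals rᵢ + rⱼ. That is, nine infinitely long straight round cylinders can mutually touch (the 9-knot); this is the ultimate configuration permitted by the count of degrees of freedom, in which only three radii can be chosen freely and the remaining six are determined. -/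
/-- Closed intervals of real numbers with rational center and radius. -/
structure RatBall where
  center : ℚ
  radius : ℚ

namespace RatBall

/-- A real number lies in the interval. -/
def Mem (I : RatBall) (x : ℝ) : Prop := |x - I.center| ≤ I.radius

instance : Add RatBall := ⟨fun I J => ⟨I.center + J.center, I.radius + J.radius⟩⟩
instance : Sub RatBall := ⟨fun I J => ⟨I.center - J.center, I.radius + J.radius⟩⟩
instance : Mul RatBall := ⟨fun I J => ⟨I.center * J.center,
  |I.center| * J.radius + I.radius * |J.center| + I.radius * J.radius⟩⟩

variable {I J : RatBall} {x y : ℝ}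

theorem mem_singleton (q : ℚ) : Mem ⟨q, 0⟩ q := by simp [Mem]

theorem Mem.add (hx : I.Mem x) (hy : J.Mem y) : (I + J).Mem (x + y) := by
  change |x + y - ((I.center + J.center : ℚ) : ℝ)| ≤ ((I.radius + J.radius : ℚ) : ℝ)
  push_cast
  rw [add_sub_add_comm]
  exact (abs_add_le _ _).trans (add_le_add hx hy)

theorem Mem.sub (hx : I.Mem x) (hy : J.Mem y) : (I - J).Mem (x - y) := by
  change |x - y - ((I.center - J.center : ℚ) : ℝ)| ≤ ((I.radius + J.radius : ℚ) : ℝ)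
  push_cast
  rw [sub_sub_sub_comm]
  exact (abs_sub _ _).trans (add_le_add hx hy)

theorem Mem.mul (hx : I.Mem x) (hy : J.Mem y) : (I * J).Mem (x * y) := by
  change |x * y - ((I.center * J.center : ℚ) : ℝ)| ≤
    ((|I.center| * J.radius + I.radius * |J.center| + I.radius * J.radius : ℚ) : ℝ)
  unfold Mem at hx hy
  push_cast
  have key : x * y - I.center * J.center = I.center * (y - J.center) +
      (x - I.center) * J.center + (x - I.center) * (y - J.center) := by ring
  rw [key]
  refine (abs_add_three _ _ _).trans ?_
  simp only [abs_mul]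
  gcongr
  exact (abs_nonneg _).trans hx

theorem Mem.pos (hx : I.Mem x) (hI : I.radius < I.center) : 0 < x := by
  have h : (I.radius : ℝ) < I.center := by exact_mod_cast hI
  linarith [(abs_le.1 hx).1]

end RatBall

/-- Polynomial expressions with rational coefficients in `n` variables. -/
inductive PolyExpr (n : ℕ)
  | const (q : ℚ)
  | var (i : Fin n)
  | add (a b : PolyExpr n)
  | sub (a b : PolyExpr n)
  | mul (a b : PolyExpr n)

namespace PolyExpr

variable {n : ℕ}

instance : Zero (PolyExpr n) := ⟨const 0⟩
instance : One (PolyExpr n) := ⟨const 1⟩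
instance : Add (PolyExpr n) := ⟨add⟩
instance : Sub (PolyExpr n) := ⟨sub⟩
instance : Mul (PolyExpr n) := ⟨mul⟩

/-- The value of a polynomial expression at a point. -/
def eval {K : Type*} [DivisionRing K] (x : Fin n → K) : PolyExpr n → K
  | const q => q
  | var i => x i
  | add a b => eval x a + eval x b
  | sub a b => eval x a - eval x b
  | mul a b => eval x a * eval x b

section

variable {K : Type*} [DivisionRing K] (x : Fin n → K) (a : PolyExpr n)

@[simp] theorem eval_var (i : Fin n) : eval x (var i) = x i := rfl

@[simp] theorem eval_zero [CharZero K] : eval x (0 : PolyExpr n) = 0 := Rat.cast_zero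
@[simp] theorem eval_one [CharZero K] : eval x (1 : PolyExpr n) = 1 := Rat.cast_one

theorem eval_ratCast [CharZero K] (c : Fin n → ℚ) :
    eval (fun i => (c i : K)) a = (eval c a : ℚ) := by
  induction a with
  | const q => simp [eval]
  | var i => rfl
  | add a b iha ihb => simp [eval, iha, ihb]
  | sub a b iha ihb => simp [eval, iha, ihb]
  | mul a b iha ihb => simp [eval, iha, ihb]

end

/-- An interval containing the values of a polynomial expression on the box `B`. -/
def range (B : Fin n → RatBall) : PolyExpr n → RatBall
  | const q => ⟨q, 0⟩
  | var i => B i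
  | add a b => range B a + range B b
  | sub a b => range B a - range B b
  | mul a b => range B a * range B b

/-- Intervals containing, on the box `B`, the coefficients of a linear expansion of differences of
values of a polynomial expression. -/
def slope (B : Fin n → RatBall) (j : Fin n) : PolyExpr n → RatBall
  | const _ => ⟨0, 0⟩
  | var i => ⟨if i = j then 1 else 0, 0⟩
  | add a b => slope B j a + slope B j b
  | sub a b => slope B j a - slope B j b
  | mul a b => range B a * slope B j b + slope B j a * range B b

variable {B : Fin n → RatBall} {x y : Fin n → ℝ}

theorem range_mem (hx : ∀ i, (B i).Mem (x i)) (a : PolyExpr n) : (range B a).Mem (eval x a) := by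
  induction a with
  | const q => exact RatBall.mem_singleton q
  | var i => exact hx i
  | add a b iha ihb => exact iha.add ihb
  | sub a b iha ihb => exact iha.sub ihb
  | mul a b iha ihb => exact iha.mul ihb

theorem exists_slope (hx : ∀ i, (B i).Mem (x i)) (hy : ∀ i, (B i).Mem (y i)) (a : PolyExpr n) :
    ∃ g : Fin n → ℝ, (∀ j, (slope B j a).Mem (g j)) ∧
      eval x a - eval y a = ∑ j, g j * (x j - y j) := by
  induction a with
  | const q => exact ⟨0, fun j => by simpa [slope] using RatBall.mem_singleton 0, by simp [eval]⟩
  | var i =>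
    refine ⟨fun j => ((if i = j then 1 else 0 : ℚ) : ℝ), fun j => RatBall.mem_singleton _, ?_⟩
    simp [eval, apply_ite (Rat.cast : ℚ → ℝ)]
  | add a b iha ihb =>
    obtain ⟨g, hg, hgs⟩ := iha
    obtain ⟨h, hh, hhs⟩ := ihb
    refine ⟨g + h, fun j => (hg j).add (hh j), ?_⟩
    simp only [eval, Pi.add_apply, add_mul, Finset.sum_add_distrib, ← hgs, ← hhs]
    ring
  | sub a b iha ihb =>
    obtain ⟨g, hg, hgs⟩ := iha
    obtain ⟨h, hh, hhs⟩ := ihb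
    refine ⟨g - h, fun j => (hg j).sub (hh j), ?_⟩
    simp only [eval, Pi.sub_apply, sub_mul, Finset.sum_sub_distrib, ← hgs, ← hhs]
    ring
  | mul a b iha ihb =>
    obtain ⟨g, hg, hgs⟩ := iha
    obtain ⟨h, hh, hhs⟩ := ihb
    refine ⟨fun j => eval x a * h j + g j * eval y b,
      fun j => ((range_mem hx a).mul (hh j)).add ((hg j).mul (range_mem hy b)), ?_⟩
    have key : ∑ j, (eval x a * h j + g j * eval y b) * (x j - y j) =
        eval x a * ∑ j, h j * (x j - y j) + (∑ j, g j * (x j - y j)) * eval y b := by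
      rw [Finset.mul_sum, Finset.sum_mul, ← Finset.sum_add_distrib]
      exact Finset.sum_congr rfl fun j _ => by ring
    rw [key, ← hgs, ← hhs]
    simp only [eval]
    ring

/-- The box of radius `ρ` around `c`. -/
def box (c : Fin n → ℚ) (ρ : ℚ) (i : Fin n) : RatBall := ⟨c i, ρ⟩

/-- An upper bound for the absolute row sum with index `i` of `1 - A * G`, where `G` ranges over
the slope matrices of the system `F` on the box `B`. -/
def defect (F : Fin n → PolyExpr n) (A : Matrix (Fin n) (Fin n) ℚ) (B : Fin n → RatBall)
    (i : Fin n) : ℚ :=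
  ∑ j, (|(if i = j then 1 else 0) - ∑ k, A i k * (slope B j (F k)).center| +
    ∑ k, |A i k| * (slope B j (F k)).radius)

theorem sum_abs_le_defect {F : Fin n → PolyExpr n} {A : Matrix (Fin n) (Fin n) ℚ}
    {G : Matrix (Fin n) (Fin n) ℝ} (hG : ∀ k j, (slope B j (F k)).Mem (G k j)) (i : Fin n) :
    ∑ j, |(1 - A.map (Rat.cast : ℚ → ℝ) * G) i j| ≤ defect F A B i := by
  unfold defect
  push_cast [apply_ite (Rat.cast : ℚ → ℝ)]
  refine Finset.sum_le_sum fun j _ => ?_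
  have key : (1 - A.map (Rat.cast : ℚ → ℝ) * G) i j =
      ((if i = j then 1 else 0) - ∑ k, (A i k : ℝ) * (slope B j (F k)).center) -
        ∑ k, (A i k : ℝ) * (G k j - (slope B j (F k)).center) := by
    simp only [Matrix.sub_apply, Matrix.one_apply, Matrix.mul_apply, Matrix.map_apply, mul_sub,
      Finset.sum_sub_distrib]
    ring
  rw [key]
  refine (abs_sub _ _).trans (add_le_add le_rfl ?_)
  refine (Finset.abs_sum_le_sum_abs _ _).trans (Finset.sum_le_sum fun k _ => ?_)
  rw [abs_mul]
  exact mul_le_mul_of_nonneg_left (hG k j) (abs_nonneg _)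

/-- The **Krawczyk test**: a computable criterion for a system of polynomial equations to have a
zero in a given box. -/
theorem exists_zero_of_krawczyk (F : Fin n → PolyExpr n) (A : Matrix (Fin n) (Fin n) ℚ)
    (c : Fin n → ℚ) (ρ : ℚ) (hρ : 0 ≤ ρ) (hA : ∀ i, defect F A (box c ρ) i ≤ 1 / 2)
    (hc : ∀ i, |∑ k, A i k * eval c (F k)| ≤ ρ / 2) :
    ∃ x : Fin n → ℝ, (∀ i, (box c ρ i).Mem (x i)) ∧ ∀ k, eval x (F k) = 0 := by
  set A' : Matrix (Fin n) (Fin n) ℝ := A.map (Rat.cast : ℚ → ℝ) with hA'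
  set c' : Fin n → ℝ := fun i => c i with hc'
  let T : (Fin n → ℝ) → Fin n → ℝ := fun x => x - A'.mulVec fun k => eval x (F k)
  let s : Set (Fin n → ℝ) := {x | ∀ i, (box c ρ i).Mem (x i)}
  have hcs : c' ∈ s := fun i => by simpa [box, RatBall.Mem, hc'] using hρ
  have hslope : ∀ x ∈ s, ∀ y ∈ s, ∃ G : Matrix (Fin n) (Fin n) ℝ,
      (∀ i, ∑ j, |(1 - A' * G) i j| ≤ 1 / 2) ∧ T x - T y = (1 - A' * G).mulVec (x - y) := by
    intro x hx y hy
    choose G hG hGs using fun k => exists_slope hx hy (F k)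
    refine ⟨Matrix.of G, fun i => (sum_abs_le_defect hG i).trans ?_, ?_⟩
    · exact (Rat.cast_le.2 (hA i)).trans_eq (by norm_num)
    · have hF : (fun k => eval x (F k)) - (fun k => eval y (F k)) =
          (Matrix.of G).mulVec (x - y) := funext hGs
      rw [Matrix.sub_mulVec, Matrix.one_mulVec, ← Matrix.mulVec_mulVec, ← hF, Matrix.mulVec_sub]
      simp only [T]
      abel
  have hdist : ∀ x ∈ s, ∀ y ∈ s, dist (T x) (T y) ≤ 1 / 2 * dist x y := by
    intro x hx y hy
    obtain ⟨G, hG, hT⟩ := hslope x hx y hy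
    refine (dist_pi_le_iff (by positivity)).2 fun i => ?_
    rw [Real.dist_eq, ← Pi.sub_apply, hT, Matrix.mulVec, dotProduct]
    refine (Finset.abs_sum_le_sum_abs _ _).trans ?_
    refine le_trans ?_ (mul_le_mul_of_nonneg_right (hG i) dist_nonneg)
    rw [Finset.sum_mul]
    refine Finset.sum_le_sum fun j _ => ?_
    rw [abs_mul]
    exact mul_le_mul_of_nonneg_left (dist_le_pi_dist x y j) (abs_nonneg _)
  have hs : s = Metric.closedBall c' ρ := by
    ext x
    simp [s, dist_pi_le_iff (show (0 : ℝ) ≤ ρ by exact_mod_cast hρ), box, RatBall.Mem, hc',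
      Real.dist_eq]
  have hTc : dist (T c') c' ≤ ρ / 2 := by
    refine (dist_pi_le_iff (by positivity)).2 fun i => ?_
    have h : |((∑ k, A i k * eval c (F k) : ℚ) : ℝ)| ≤ ρ / 2 := by exact_mod_cast hc i
    simpa [T, Real.dist_eq, Matrix.mulVec, dotProduct, hc', hA', eval_ratCast] using h
  have hmaps : Set.MapsTo T s s := by
    intro x hx
    have hxc : dist x c' ≤ ρ := by simpa [hs] using hx
    rw [hs, Metric.mem_closedBall]
    linarith [dist_triangle (T x) (T c') c', hdist x hx c' hcs]
  have hcontr : ContractingWith (1 / 2) (hmaps.restrict T s s) := by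
    refine ⟨by norm_num, LipschitzWith.of_dist_le_mul fun x y => ?_⟩
    simpa [Subtype.dist_eq] using hdist x x.2 y y.2
  have hcomplete : IsComplete s := by
    rw [hs]
    exact Metric.isClosed_closedBall.isComplete
  obtain ⟨x, hxs, hx, -⟩ :=
    hcontr.exists_fixedPoint' hcomplete hmaps hcs (edist_ne_top _ _)
  refine ⟨x, hxs, fun k => ?_⟩
  obtain ⟨G, hG, -⟩ := hslope x hxs x hxs
  have hdet : (A' * G).det ≠ 0 := by
    refine det_ne_zero_of_sum_row_lt_diag fun i => ?_
    have h := hG i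
    rw [← Finset.add_sum_erase _ _ (Finset.mem_univ i)] at h
    have h' : ∑ j ∈ Finset.univ.erase i, |(1 - A' * G) i j| =
        ∑ j ∈ Finset.univ.erase i, ‖(A' * G) i j‖ :=
      Finset.sum_congr rfl fun j hj => by
        rw [Matrix.sub_apply, Matrix.one_apply_ne' (Finset.ne_of_mem_erase hj), zero_sub, abs_neg,
          Real.norm_eq_abs]
    rw [h', Matrix.sub_apply, Matrix.one_apply_eq] at h
    have := abs_sub_abs_le_abs_sub 1 ((A' * G) i i)
    rw [abs_one] at this
    rw [Real.norm_eq_abs]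
    linarith
  rw [Matrix.det_mul] at hdet
  have hzero : A'.mulVec (fun k => eval x (F k)) = 0 := sub_eq_self.1 hx
  exact congrFun (Matrix.eq_zero_of_mulVec_eq_zero (left_ne_zero_of_mul hdet) hzero) k

end PolyExpr

/-- A round cylinder, given by a point on its axis, a direction vector and its radius. -/
@[ext]
structure Cylinder (R : Type*) where
  point : Fin 3 → R
  dir : Fin 3 → R
  radius : R

namespace Cylinder

section

variable {R S : Type*}

/-- The image of a cylinder under a map applied to all coordinates. -/
def map (f : R → S) (C : Cylinder R) : Cylinder S :=
  ⟨fun i => f (C.point i), fun i => f (C.dir i), f C.radius⟩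

/-- The image of a cylinder under a cyclic permutation of the coordinate axes. -/
def rotate (n : Fin 3) (C : Cylinder R) : Cylinder R :=
  ⟨fun i => C.point (i - n), fun i => C.dir (i - n), C.radius⟩

theorem rotate_rotate (m n : Fin 3) (C : Cylinder R) :
    (C.rotate n).rotate m = C.rotate (m + n) := by
  simp [rotate, sub_sub]

variable [Sub R] [Mul R]

/-- The cross product of the direction vectors of two cylinders. -/
def normal (C D : Cylinder R) : Fin 3 → R :=
  ![C.dir 1 * D.dir 2 - C.dir 2 * D.dir 1, C.dir 2 * D.dir 0 - C.dir 0 * D.dir 2,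
    C.dir 0 * D.dir 1 - C.dir 1 * D.dir 0]

variable [Add R]

/-- The squared length of the cross product of the direction vectors of two cylinders. -/
def normalSq (C D : Cylinder R) : R :=
  C.normal D 0 * C.normal D 0 + C.normal D 1 * C.normal D 1 + C.normal D 2 * C.normal D 2

/-- The triple product of the two direction vectors and the difference of the base points. -/
def offset (C D : Cylinder R) : R :=
  (C.point 0 - D.point 0) * C.normal D 0 + (C.point 1 - D.point 1) * C.normal D 1 +
    (C.point 2 - D.point 2) * C.normal D 2

/-- The polynomial whose vanishing expresses that two cylinders with skew axes touch. -/
def contact (C D : Cylinder R) : R :=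
  C.offset D * C.offset D -
    (C.radius + D.radius) * (C.radius + D.radius) * C.normalSq D

end

/-- The axes of the two cylinders are not parallel, and the cylinders touch. -/
structure Touches (C D : Cylinder ℝ) : Prop where
  normalSq_pos : 0 < C.normalSq D
  contact_eq_zero : C.contact D = 0

namespace Touches

variable {C D : Cylinder ℝ}

theorem symm (h : C.Touches D) : D.Touches C := by
  have hn : D.normalSq C = C.normalSq D := by
    simp only [normalSq, normal, Matrix.cons_val]
    ring
  have hc : D.contact C = C.contact D := by
    rw [contact, hn]
    simp only [contact, offset, normal, Matrix.cons_val]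
    ring
  exact ⟨hn ▸ h.normalSq_pos, hc ▸ h.contact_eq_zero⟩

theorem rotate (h : C.Touches D) (n : Fin 3) : (C.rotate n).Touches (D.rotate n) := by
  have h₁ : (-1 : Fin 3) = 2 := rfl
  have h₂ : (-2 : Fin 3) = 1 := rfl
  have hn : (C.rotate n).normalSq (D.rotate n) = C.normalSq D := by
    fin_cases n <;> simp [normalSq, normal, Cylinder.rotate, h₁, h₂] <;> ring
  have ho : (C.rotate n).offset (D.rotate n) = C.offset D := by
    fin_cases n <;> simp [offset, normal, Cylinder.rotate, h₁, h₂] <;> ring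
  have hc : (C.rotate n).contact (D.rotate n) = C.contact D := by
    rw [contact, hn, ho]
    rfl
  exact ⟨hn ▸ h.normalSq_pos, hc ▸ h.contact_eq_zero⟩

theorem linearIndependent (h : C.Touches D) :
    LinearIndependent ℝ ![WithLp.toLp 2 C.dir, WithLp.toLp 2 D.dir] := by
  have key : ∀ {C D : Cylinder ℝ}, C.Touches D → ∀ s t : ℝ,
      s • WithLp.toLp 2 C.dir + t • WithLp.toLp 2 D.dir = 0 → s = 0 := by
    intro C D h s t hst
    have hi : ∀ i, s * C.dir i + t * D.dir i = 0 := fun i => by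
      simpa using congrArg (fun v : EuclideanSpace ℝ (Fin 3) => v i) hst
    have hs : s * C.normalSq D = 0 := by
      simp only [normalSq, normal, Matrix.cons_val]
      linear_combination

        ((C.dir 1 * D.dir 2 - C.dir 2 * D.dir 1) * D.dir 2 -
          (C.dir 0 * D.dir 1 - C.dir 1 * D.dir 0) * D.dir 0) * hi 1 +
        ((C.dir 2 * D.dir 0 - C.dir 0 * D.dir 2) * D.dir 0 -
          (C.dir 1 * D.dir 2 - C.dir 2 * D.dir 1) * D.dir 1) * hi 2 +
        ((C.dir 0 * D.dir 1 - C.dir 1 * D.dir 0) * D.dir 1 -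
          (C.dir 2 * D.dir 0 - C.dir 0 * D.dir 2) * D.dir 2) * hi 0
    exact (mul_eq_zero.1 hs).resolve_right h.normalSq_pos.ne'
  refine LinearIndependent.pair_iff.2 fun s t hst => ⟨key h s t hst, key h.symm t s ?_⟩
  rwa [add_comm]

theorem lineDist_eq (h : C.Touches D) (hr : 0 ≤ C.radius + D.radius) :
    lineDist (WithLp.toLp 2 C.point) (WithLp.toLp 2 C.dir) (WithLp.toLp 2 D.point)
      (WithLp.toLp 2 D.dir) = C.radius + D.radius := by
  have hW := h.normalSq_pos
  have hc : C.offset D ^ 2 = (C.radius + D.radius) ^ 2 * C.normalSq D := by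
    have := h.contact_eq_zero
    rw [contact] at this
    linarith
  have hdist : ∀ t₁ t₂ : ℝ, dist (WithLp.toLp 2 C.point + t₁ • WithLp.toLp 2 C.dir)
      (WithLp.toLp 2 D.point + t₂ • WithLp.toLp 2 D.dir) =
      √(∑ i, (C.point i + t₁ * C.dir i - (D.point i + t₂ * D.dir i)) ^ 2) := fun t₁ t₂ => by
    simp [EuclideanSpace.dist_eq, Real.dist_eq, sq_abs]
  refine IsLeast.csInf_eq ⟨?_, ?_⟩
  · let d : Fin 3 → ℝ := fun i => C.point i - D.point i
    let n := C.normal D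
    let t₁ := -(d 0 * (D.dir 1 * n 2 - D.dir 2 * n 1) + d 1 * (D.dir 2 * n 0 - D.dir 0 * n 2) +
      d 2 * (D.dir 0 * n 1 - D.dir 1 * n 0)) / C.normalSq D
    let t₂ := -(d 0 * (C.dir 1 * n 2 - C.dir 2 * n 1) + d 1 * (C.dir 2 * n 0 - C.dir 0 * n 2) +
      d 2 * (C.dir 0 * n 1 - C.dir 1 * n 0)) / C.normalSq D
    have hi : ∀ i, C.point i + t₁ * C.dir i - (D.point i + t₂ * D.dir i) =
        C.offset D / C.normalSq D * n i := by
      intro i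
      rw [← mul_left_inj' hW.ne']
      have h₁ : t₁ * C.normalSq D = _ := div_mul_cancel₀ _ hW.ne'
      have h₂ : t₂ * C.normalSq D = _ := div_mul_cancel₀ _ hW.ne'
      have h₃ : C.offset D / C.normalSq D * C.normalSq D = _ := div_mul_cancel₀ _ hW.ne'
      have h₄ : d i * C.normalSq D = C.offset D * n i -
          (t₁ * C.normalSq D) * C.dir i + (t₂ * C.normalSq D) * D.dir i := by
        rw [h₁, h₂]
        fin_cases i <;> simp [d, n, normalSq, offset, normal] <;> ring
      linear_combination h₄ - n i * h₃
    refine ⟨t₁, t₂, ?_⟩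
    rw [hdist]
    simp only [hi, mul_pow, ← Finset.mul_sum]
    have hn : ∑ i, n i ^ 2 = C.normalSq D := by
      simp only [Fin.sum_univ_three, n, normalSq]
      ring
    rw [hn, div_pow, hc]
    have : (C.radius + D.radius) ^ 2 * C.normalSq D / C.normalSq D ^ 2 * C.normalSq D =
        (C.radius + D.radius) ^ 2 := by
      field_simp
    rw [this, Real.sqrt_sq hr]
  · rintro _ ⟨t₁, t₂, rfl⟩
    rw [hdist]
    refine Real.le_sqrt_of_sq_le ?_
    rw [← mul_le_mul_iff_left₀ hW, ← hc]
    let e : Fin 3 → ℝ := fun i => C.point i + t₁ * C.dir i - (D.point i + t₂ * D.dir i)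
    have he : C.offset D = ∑ i, e i * C.normal D i := by
      simp [Fin.sum_univ_three, e, offset, normal]
      ring
    have hn : ∑ i, C.normal D i ^ 2 = C.normalSq D := by
      simp only [Fin.sum_univ_three, normalSq]
      ring
    rw [he, ← hn]
    exact Finset.sum_mul_sq_le_sq_mul_sq _ _ _

end Touches

end Cylinder

namespace NineKnot

open Cylinder PolyExpr

/-- Representatives of the three orbits of cylinders under the rotations about the axis `(1, 1, 1)`,
in terms of twelve parameters. -/
def orbitRep {R : Type*} [Zero R] [One R] (x : Fin 12 → R) : Fin 3 → Cylinder R :=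
  ![⟨![0, x 1, 0], ![0, x 0, 1], 1⟩,
    ⟨![x 4, x 5, 0], ![x 2, x 3, 1], x 6⟩,
    ⟨![x 9, x 10, 0], ![x 7, x 8, 1], x 11⟩]

/-- Representatives `(k, l, n)` of the orbits of pairs of cylinders, standing for the pair formed by
the `k`-th orbit representative and the `l`-th one rotated `n` times. -/
def pairRep : Fin 12 → Fin 3 × Fin 3 × Fin 3 :=
  ![(0, 0, 1), (1, 1, 1), (2, 2, 1), (0, 1, 0), (0, 1, 1), (0, 1, 2),
    (0, 2, 0), (0, 2, 1), (0, 2, 2), (1, 2, 0), (1, 2, 1), (1, 2, 2)]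

/-- The contact equations. -/
def equations (e : Fin 12) : PolyExpr 12 :=
  (orbitRep var (pairRep e).1).contact
    ((orbitRep var (pairRep e).2.1).rotate (pairRep e).2.2)

/-- The squared lengths of the common normals. -/
def normals (e : Fin 12) : PolyExpr 12 :=
  (orbitRep var (pairRep e).1).normalSq
    ((orbitRep var (pairRep e).2.1).rotate (pairRep e).2.2)

/-- An approximate solution of the contact equations. -/
def center : Fin 12 → ℚ := fun i =>
  ![-233803, -901162, -77569, -35928, -556558, 28090, 36179, 40814, 5610, -641134, 846764,
    761633] i / 100000

/-- An approximate inverse of the Jacobian matrix of the contact equations. -/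
def preconditioner : Matrix (Fin 12) (Fin 12) ℚ := fun i j =>
  !![190, -2266, 77, -1278, -408, 4830, -91, -76, -275, 741, 179, 311;
    -275, -412, 14, -233, -74, 879, -17, -14, -50, 135, 33, 57;
    -18, -21, -9, 112, 66, -397, 12, 1, 20, -51, -36, -7;
    31, -534, 17, -179, -57, 744, -22, -9, -49, 130, 57, 39;
    -479, 3616, -126, 1920, 1011, -9867, 155, 103, 419, -1126, -337, -432;
    -37, -678, -10, -122, 206, 1518, 11, 10, 36, -97, -21, -42;
    -18, -278, -20, 105, -41, -399, 25, 16, 66, -178, -54, -68;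
    -28, 488, -30, 206, 59, -1071, 18, 3, 64, -134, -10, -33;
    -1, 307, 4, 79, 16, -694, -3, -8, 34, -66, 15, 4;
    -167, 1528, 17, 140, -27, -3570, -59, 69, -69, -237, 180, 141;
    386, -3692, -52, -1329, -349, 8197, -82, -136, 20, 933, -23, 140;
    364, -2865, -49, -1016, -265, 6367, -76, -148, -23, 719, -24, 101] i j / 10000

theorem exists_solution : ∃ x : Fin 12 → ℝ,
    (∀ i, (box center (1 / 10000) i).Mem (x i)) ∧ ∀ e, eval x (equations e) = 0 := by
  refine exists_zero_of_krawczyk equations preconditioner center _ (by norm_num) ?_ ?_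
  · decide +kernel
  · decide +kernel

theorem radius_lt_center_normals (e : Fin 12) :
    (range (box center (1 / 10000)) (normals e)).radius <
      (range (box center (1 / 10000)) (normals e)).center := by
  revert e
  decide +kernel

theorem map_orbitRep (x : Fin 12 → ℝ) (k : Fin 3) :
    (orbitRep var k).map (eval x) = orbitRep x k := by
  fin_cases k <;> ext i <;> (try fin_cases i) <;> simp [orbitRep, Cylinder.map]

theorem eval_equations (x : Fin 12 → ℝ) (e : Fin 12) :
    eval x (equations e) = (orbitRep x (pairRep e).1).contact
      ((orbitRep x (pairRep e).2.1).rotate (pairRep e).2.2) := by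
  rw [← map_orbitRep, ← map_orbitRep]
  rfl

theorem eval_normals (x : Fin 12 → ℝ) (e : Fin 12) :
    eval x (normals e) = (orbitRep x (pairRep e).1).normalSq
      ((orbitRep x (pairRep e).2.1).rotate (pairRep e).2.2) := by
  rw [← map_orbitRep, ← map_orbitRep]
  rfl

theorem pairRep_surjective (k l n : Fin 3) (h : k = l → n ≠ 0) :
    ∃ e, pairRep e = (k, l, n) ∨ pairRep e = (l, k, -n) := by
  revert k l n
  decide

/-- Nine mutually touching cylinders with a threefold symmetry. -/
theorem exists_touches : ∃ C : Fin 3 → Cylinder ℝ, (C 0).radius = 1 ∧ (∀ k, 0 < (C k).radius) ∧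
    ∀ k l m n, (k, m) ≠ (l, n) → ((C k).rotate m).Touches ((C l).rotate n) := by
  obtain ⟨x, hx, hF⟩ := exists_solution
  have hrep : ∀ e, (orbitRep x (pairRep e).1).Touches
      ((orbitRep x (pairRep e).2.1).rotate (pairRep e).2.2) := fun e =>
    ⟨eval_normals x e ▸ (range_mem hx _).pos (radius_lt_center_normals e),
      eval_equations x e ▸ hF e⟩
  refine ⟨orbitRep x, rfl, fun k => ?_, fun k l m n hne => ?_⟩
  · fin_cases k
    · exact one_pos
    · exact (hx 6).pos (by decide +kernel)
    · exact (hx 11).pos (by decide +kernel)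
  · obtain ⟨e, he | he⟩ := pairRep_surjective k l (n - m) fun hkl hmn =>
      hne (by rw [hkl, sub_eq_zero.1 hmn])
    · have h := (hrep e).rotate m
      rwa [he, rotate_rotate, add_sub_cancel] at h
    · have h := ((hrep e).rotate n).symm
      rwa [he, rotate_rotate, neg_sub, add_sub_cancel] at h

end NineKnot

/-- The 9-knot: nine mutually touching infinite straight round cylinders
(with `r₀ = r₁ = 1`), the ultimate configuration permitted by the count of
degrees of freedom. -/
theorem stmt11 :
    ∃ (p v : Fin 9 → EuclideanSpace ℝ (Fin 3)) (r : Fin 9 → ℝ),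
      (∀ i, v i ≠ 0) ∧
      (∀ i, 0 < r i) ∧
      r 0 = 1 ∧ r 1 = 1 ∧
      (∀ i j, i ≠ j → LinearIndependent ℝ ![v i, v j]) ∧
      (∀ i j, i ≠ j → lineDist (p i) (v i) (p j) (v j) = r i + r j) := by
  obtain ⟨C, hC, hpos, hT⟩ := NineKnot.exists_touches
  let idx : Fin 9 ≃ Fin 3 × Fin 3 := (finProdFinEquiv (m := 3) (n := 3)).symm
  let K : Fin 9 → Cylinder ℝ := fun i => (C (idx i).1).rotate (idx i).2
  have hK : ∀ i j, i ≠ j → (K i).Touches (K j) := fun i j hij => hT _ _ _ _ fun h =>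
    hij (idx.injective h)
  have hind : ∀ i j, i ≠ j →
      LinearIndependent ℝ ![WithLp.toLp 2 (K i).dir, WithLp.toLp 2 (K j).dir] :=
    fun i j hij => (hK i j hij).linearIndependent
  refine ⟨fun i => WithLp.toLp 2 (K i).point, fun i => WithLp.toLp 2 (K i).dir,
    fun i => (K i).radius, fun i => ?_, fun i => hpos _, hC, hC, hind,
    fun i j hij => (hK i j hij).lineDist_eq (add_pos (hpos _) (hpos _)).le⟩
  exact (hind i (i + 1) (by simp)).ne_zero 0
end

section
/- For any three radii r₁, r₂, r₃ > 0 there exist a radius r₄ > 0 and points c₁, c₂, c₃, c₄ ∈ ℝ² such that dist(cᵢ, cⱼ) = rᵢ + rⱼ for all i ≠ j. That is, to any three pairwise externally tangent circles of prescribed radii one can add a fourth circle externally tangent to all three, whose radius is determined by the other three (the case N = 4, N_F = −1 of the degree-of-freedom equation for circles; the Apollonius/inner Soddy circle). -/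
theorem dist_euclideanPlane_eq {x y u v R : ℝ} (hR : 0 ≤ R)
    (h : (x - u) ^ 2 + (y - v) ^ 2 = R ^ 2) :
    dist (!₂[x, y] : EuclideanSpace ℝ (Fin 2)) !₂[u, v] = R := by
  rw [EuclideanSpace.dist_eq]
  simp [Fin.sum_univ_two, Real.dist_eq, h, Real.sqrt_sq hR]

/-- The radius `d` of the inner Soddy circle of three tangent circles of radii `a`, `b`, `c`,
together with the areas `s` and `t` of the triangles of sides `a + b, b + c, c + a` and
`a + b, b + d, d + a`. -/
theorem exists_soddy_radius {a b c : ℝ} (ha : 0 < a) (hb : 0 < b) (hc : 0 < c) :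
    ∃ d s t : ℝ, 0 < d ∧ s ^ 2 = a * b * c * (a + b + c) ∧ t ^ 2 = a * b * d * (a + b + d) ∧
      2 * s * t = a * b * (a + b) * (c + d) - (a ^ 2 + b ^ 2) * (c * d) := by
  obtain ⟨s, hs₀, hs⟩ : ∃ s : ℝ, 0 ≤ s ∧ s ^ 2 = a * b * c * (a + b + c) :=
    ⟨√(a * b * c * (a + b + c)), Real.sqrt_nonneg _, Real.sq_sqrt (by positivity)⟩
  have hD : 0 < a * b + b * c + c * a + 2 * s := by positivity
  refine ⟨a * b * c / (a * b + b * c + c * a + 2 * s), s,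
    a * b * (s + c * (a + b)) / (a * b + b * c + c * a + 2 * s), by positivity, hs, ?_, ?_⟩
  · field_simp
    linear_combination hs
  · field_simp
    linear_combination 2 * hs

/-- To any three prescribed radii there is a fourth radius and a placement of
four pairwise externally tangent circles in the plane (Apollonius/inner Soddy
circle). -/
theorem stmt16 (r₁ r₂ r₃ : ℝ) (h₁ : 0 < r₁) (h₂ : 0 < r₂) (h₃ : 0 < r₃) :
    ∃ (r₄ : ℝ) (c : Fin 4 → EuclideanSpace ℝ (Fin 2)),
      0 < r₄ ∧
      ∀ i j, i ≠ j → dist (c i) (c j) = ![r₁, r₂, r₃, r₄] i + ![r₁, r₂, r₃, r₄] j := by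
  obtain ⟨r₄, s, t, h₄, hs, ht, hst⟩ := exists_soddy_radius h₁ h₂ h₃
  set c : Fin 4 → EuclideanSpace ℝ (Fin 2) := ![!₂[0, 0], !₂[r₁ + r₂, 0],
    !₂[(r₁ ^ 2 + r₁ * r₂ + r₁ * r₃ - r₂ * r₃) / (r₁ + r₂), 2 * s / (r₁ + r₂)],
    !₂[(r₁ ^ 2 + r₁ * r₂ + r₁ * r₄ - r₂ * r₄) / (r₁ + r₂), 2 * t / (r₁ + r₂)]]
  have h01 : dist (c 0) (c 1) = r₁ + r₂ :=
    dist_euclideanPlane_eq (by positivity) (by ring)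
  have h02 : dist (c 0) (c 2) = r₁ + r₃ :=
    dist_euclideanPlane_eq (by positivity) (by field_simp; linear_combination 4 * hs)
  have h03 : dist (c 0) (c 3) = r₁ + r₄ :=
    dist_euclideanPlane_eq (by positivity) (by field_simp; linear_combination 4 * ht)
  have h12 : dist (c 1) (c 2) = r₂ + r₃ :=
    dist_euclideanPlane_eq (by positivity) (by field_simp; linear_combination 4 * hs)
  have h13 : dist (c 1) (c 3) = r₂ + r₄ :=
    dist_euclideanPlane_eq (by positivity) (by field_simp; linear_combination 4 * ht)
  have h23 : dist (c 2) (c 3) = r₃ + r₄ :=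
    dist_euclideanPlane_eq (by positivity)
      (by field_simp; linear_combination 4 * hs + 4 * ht - 4 * hst)
  clear_value c
  refine ⟨r₄, c, h₄, fun i j hij => ?_⟩
  wlog h : i < j generalizing i j
  · rw [dist_comm, add_comm]
    exact this j i hij.symm (lt_of_le_of_ne (not_lt.mp h) hij.symm)
  fin_cases i <;> fin_cases j <;> first | exact absurd h (by decide) | assumption
end
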